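/- There exists a unique family (P_σ)_{σ∈S_η} of elements of F such that f = Σ_{σ∈S_η} D_σ^η(f)·P_σ for every f ∈ F. Moreover each P_σ is a homogeneous polynomial in ℂ[X_η] of degree ℓ(σ), and P_σ ≡ (1/η!)·∂_{σ⁻¹w_η}(Δ_η) modulo I, where I is the ideal of ℂ[X_η] generated by the S_η-invariant elements of p_η. -/

import Mathlib

open scoped BigOperators

noncomputable section

namespace GTpaper

variable (r : ℕ) (η : Fin r → ℕ)

/-- The index set Σ(η): pairs (k,i) with 1 ≤ k ≤ r, 1 ≤ i ≤ η_k (0-based). -/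
abbrev Idx := (k : Fin r) × Fin (η k)

/-- The polynomial ring ℂ[X_η]. -/
abbrev Pol := MvPolynomial (Idx r η) ℂ

/-- The field of rational functions F = ℂ(X_η). -/
abbrev FF := FractionRing (Pol r η)

/-- The group S_η = S_{η_1} × ⋯ × S_{η_r}. -/
abbrev Sg := ∀ k : Fin r, Equiv.Perm (Fin (η k))

/-- The action of S_η on the index set. -/
def permIdx (σ : Sg r η) : Equiv.Perm (Idx r η) where
  toFun p := ⟨p.1, σ p.1 p.2⟩
  invFun p := ⟨p.1, (σ p.1)⁻¹ p.2⟩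
  left_inv p := by simp
  right_inv p := by simp

/-- The action of S_η on ℂ[X_η] by permuting variables. -/
def actP (σ : Sg r η) : Pol r η ≃+* Pol r η :=
  (MvPolynomial.renameEquiv ℂ (permIdx r η σ)).toRingEquiv

/-- The action of S_η on F = ℂ(X_η) by field automorphisms. -/
def actF (σ : Sg r η) : FF r η ≃+* FF r η :=
  IsFractionRing.ringEquivOfRingEquiv (actP r η σ)

/-- The variable x_{k,i} viewed as an element of F. -/
def XF (p : Idx r η) : FF r η := algebraMap (Pol r η) (FF r η) (MvPolynomial.X p)

/-- The element of S_η which transposes (k,i) and (k,j) and fixes all other indices. -/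
def transpT (k : Fin r) (i j : Fin (η k)) : Sg r η :=
  Function.update (1 : Sg r η) k (Equiv.swap i j)

/-- The simple transposition s_i^{(k)}. -/
def simpleT (k : Fin r) (i : ℕ) (h : i + 1 < η k) : Sg r η :=
  transpT r η k ⟨i, Nat.lt_of_succ_lt h⟩ ⟨i + 1, h⟩

/-- The divided difference operator ∂_i^{(k)} on F. -/
def dd (k : Fin r) (i : ℕ) (h : i + 1 < η k) (f : FF r η) : FF r η :=
  (f - actF r η (simpleT r η k i h) f) /
    (XF r η ⟨k, ⟨i, Nat.lt_of_succ_lt h⟩⟩ - XF r η ⟨k, ⟨i + 1, h⟩⟩)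

/-- Data indexing a simple transposition of S_η. -/
abbrev SimpleDat := (k : Fin r) × {i : ℕ // i + 1 < η k}

/-- A word in the simple transpositions of S_η. -/
abbrev Word := List (SimpleDat r η)

/-- The element of S_η represented by a word. -/
def wordPerm (w : Word r η) : Sg r η :=
  (w.map fun s => simpleT r η s.1 s.2.1 s.2.2).prod

/-- The composite ∂_{j_1} ∘ ⋯ ∘ ∂_{j_l} of divided differences along a word. -/
def ddWord (w : Word r η) (f : FF r η) : FF r η :=
  w.foldr (fun s g => dd r η s.1 s.2.1 s.2.2 g) f

/-- The length ℓ(σ): the total number of inversions of σ. -/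
def len (σ : Sg r η) : ℕ :=
  ∑ k : Fin r,
    (Finset.univ.filter fun p : Fin (η k) × Fin (η k) => p.1 < p.2 ∧ σ k p.2 < σ k p.1).card

/-- `w` is a reduced decomposition of σ. -/
def IsRed (σ : Sg r η) (w : Word r η) : Prop :=
  wordPerm r η w = σ ∧ w.length = len r η σ

/-- The longest word w_η of S_η. -/
def wEta : Sg r η := fun _ => Fin.revPerm

/-- η! = η_1! ⋯ η_r!. -/
def etaFact : ℕ := ∏ k : Fin r, Nat.factorial (η k)

/-- The Vandermonde-type product Δ_η as a polynomial. -/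
def DeltaP : Pol r η :=
  ∏ k : Fin r, ∏ p ∈ Finset.univ.filter (fun p : Fin (η k) × Fin (η k) => p.1 < p.2),
    (MvPolynomial.X (⟨k, p.1⟩ : Idx r η) - MvPolynomial.X (⟨k, p.2⟩ : Idx r η))

/-- Δ_η as an element of F. -/
def DeltaF : FF r η := algebraMap (Pol r η) (FF r η) (DeltaP r η)

/-- The symmetrization operator sym_η on F. -/
def symF (f : FF r η) : FF r η :=
  (etaFact r η : FF r η)⁻¹ * ∑ σ : Sg r η, actF r η σ f

/-- The sign of an element of S_η. -/
def sgn (σ : Sg r η) : ℤ := ∏ k : Fin r, (Equiv.Perm.sign (σ k) : ℤ)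

/-- The antisymmetrization operator asym_η on F. -/
def asymF (f : FF r η) : FF r η :=
  (etaFact r η : FF r η)⁻¹ * ∑ σ : Sg r η, (sgn r η σ : FF r η) * actF r η σ f

/-- The ideal p_η of ℂ[X_η] generated by the differences x_{k,i} - x_{k,j}. -/
def pIdeal : Ideal (Pol r η) :=
  Ideal.span {q | ∃ (k : Fin r) (i j : Fin (η k)), i < j ∧
    q = MvPolynomial.X (⟨k, i⟩ : Idx r η) - MvPolynomial.X (⟨k, j⟩ : Idx r η)}

section Length

variable {r : ℕ} {η : Fin r → ℕ}

/-- The simple transposition attached to its indexing datum. -/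
abbrev simpleRefl (s : SimpleDat r η) : Sg r η := simpleT r η s.1 s.2.1 s.2.2

/-- The first of the two indices exchanged by a simple transposition. -/
abbrev lowIdx (s : SimpleDat r η) : Fin (η s.1) := ⟨s.2.1, Nat.lt_of_succ_lt s.2.2⟩

/-- The second of the two indices exchanged by a simple transposition. -/
abbrev highIdx (s : SimpleDat r η) : Fin (η s.1) := ⟨s.2.1 + 1, s.2.2⟩

theorem lowIdx_ne_highIdx (s : SimpleDat r η) : lowIdx s ≠ highIdx s := by
  simp [lowIdx, highIdx]

theorem simpleRefl_apply_self (s : SimpleDat r η) :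
    simpleRefl s s.1 = Equiv.swap (lowIdx s) (highIdx s) := by
  simp [simpleRefl, simpleT, transpT, lowIdx, highIdx]

theorem simpleRefl_apply_of_ne (s : SimpleDat r η) {k : Fin r} (hk : k ≠ s.1) :
    simpleRefl s k = 1 := by
  simp [simpleRefl, simpleT, transpT, hk]

theorem simpleRefl_mul_self (s : SimpleDat r η) : simpleRefl s * simpleRefl s = 1 := by
  funext k
  by_cases hk : k = s.1
  · subst hk
    rw [Pi.mul_apply, simpleRefl_apply_self, Equiv.swap_mul_self, Pi.one_apply]
  · rw [Pi.mul_apply, simpleRefl_apply_of_ne s hk, one_mul, Pi.one_apply]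

theorem simpleRefl_mul_cancel_left (s : SimpleDat r η) (σ : Sg r η) :
    simpleRefl s * (simpleRefl s * σ) = σ := by
  rw [← mul_assoc, simpleRefl_mul_self, one_mul]

/-- The inversions of a permutation of `Fin n`. -/
def inversions {n : ℕ} (x : Equiv.Perm (Fin n)) : Finset (Fin n × Fin n) :=
  Finset.univ.filter fun p => p.1 < p.2 ∧ x p.2 < x p.1

theorem mem_inversions {n : ℕ} {x : Equiv.Perm (Fin n)} {p : Fin n × Fin n} :
    p ∈ inversions x ↔ p.1 < p.2 ∧ x p.2 < x p.1 := by
  simp [inversions]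

theorem len_eq_sum_card (σ : Sg r η) : len r η σ = ∑ k, (inversions (σ k)).card := rfl

theorem inversions_swap_mul {n : ℕ} (x : Equiv.Perm (Fin n)) (i : ℕ) (h : i + 1 < n)
    (hx : x⁻¹ ⟨i, Nat.lt_of_succ_lt h⟩ < x⁻¹ ⟨i + 1, h⟩) :
    inversions (Equiv.swap ⟨i, Nat.lt_of_succ_lt h⟩ ⟨i + 1, h⟩ * x) =
      insert (x⁻¹ ⟨i, Nat.lt_of_succ_lt h⟩, x⁻¹ ⟨i + 1, h⟩) (inversions x) := by
  ext ⟨a, b⟩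
  obtain ⟨a, rfl⟩ := x⁻¹.surjective a
  obtain ⟨b, rfl⟩ := x⁻¹.surjective b
  have hx' (c : Fin n) : x (x⁻¹ c) = c := x.apply_symm_apply c
  rw [Finset.mem_insert, mem_inversions, mem_inversions]
  simp only [Equiv.Perm.mul_apply, hx', Prod.mk.injEq, EmbeddingLike.apply_eq_iff_eq]
  by_cases hab : x⁻¹ a < x⁻¹ b
  · have hne : a ≠ b := by rintro rfl; exact lt_irrefl _ hab
    have hn : ¬ (a = ⟨i + 1, h⟩ ∧ b = ⟨i, Nat.lt_of_succ_lt h⟩) := by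
      rintro ⟨rfl, rfl⟩; exact lt_asymm hx hab
    simp only [hab, true_and]
    simp only [Equiv.swap_apply_def]
    simp only [Fin.ext_iff, Fin.lt_def] at *
    split_ifs <;> simp_all <;> omega
  · have : ¬ (a = ⟨i, Nat.lt_of_succ_lt h⟩ ∧ b = ⟨i + 1, h⟩) := by
      rintro ⟨rfl, rfl⟩; exact hab hx
    simp only [hab, this, false_and, or_false]

theorem card_inversions_swap_mul {n : ℕ} (x : Equiv.Perm (Fin n)) (i : ℕ) (h : i + 1 < n)
    (hx : x⁻¹ ⟨i, Nat.lt_of_succ_lt h⟩ < x⁻¹ ⟨i + 1, h⟩) :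
    (inversions (Equiv.swap ⟨i, Nat.lt_of_succ_lt h⟩ ⟨i + 1, h⟩ * x)).card =
      (inversions x).card + 1 := by
  rw [inversions_swap_mul x i h hx, Finset.card_insert_of_notMem]
  simp [inversions]

theorem len_simpleRefl_mul_of_lt (s : SimpleDat r η) (σ : Sg r η)
    (h : (σ s.1)⁻¹ (lowIdx s) < (σ s.1)⁻¹ (highIdx s)) :
    len r η (simpleRefl s * σ) = len r η σ + 1 := by
  rw [len_eq_sum_card, len_eq_sum_card, ← Finset.add_sum_erase _ _ (Finset.mem_univ s.1),
    ← Finset.add_sum_erase _ _ (Finset.mem_univ s.1), Pi.mul_apply, simpleRefl_apply_self,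
    card_inversions_swap_mul _ _ s.2.2 h, Finset.sum_congr rfl, add_right_comm]
  intro k hk
  rw [Pi.mul_apply, simpleRefl_apply_of_ne s (Finset.ne_of_mem_erase hk), one_mul]

theorem len_simpleRefl_mul_of_gt (s : SimpleDat r η) (σ : Sg r η)
    (h : (σ s.1)⁻¹ (highIdx s) < (σ s.1)⁻¹ (lowIdx s)) :
    len r η (simpleRefl s * σ) + 1 = len r η σ := by
  rw [← len_simpleRefl_mul_of_lt s (simpleRefl s * σ), simpleRefl_mul_cancel_left]
  simpa [simpleRefl_apply_self] using h

theorem len_simpleRefl_mul (s : SimpleDat r η) (σ : Sg r η) :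
    len r η (simpleRefl s * σ) = len r η σ + 1 ∨ len r η (simpleRefl s * σ) + 1 = len r η σ := by
  rcases lt_trichotomy ((σ s.1)⁻¹ (lowIdx s)) ((σ s.1)⁻¹ (highIdx s)) with h | h | h
  · exact Or.inl (len_simpleRefl_mul_of_lt s σ h)
  · exact absurd ((σ s.1)⁻¹.injective h) (lowIdx_ne_highIdx s)
  · exact Or.inr (len_simpleRefl_mul_of_gt s σ h)

theorem perm_eq_one_of_strictMono {n : ℕ} (x : Equiv.Perm (Fin n)) (hx : StrictMono x) :
    x = 1 := by
  have : (x : Fin n → Fin n) = id :=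
    (StrictMono.range_inj hx strictMono_id).1 (by simp [x.surjective.range_eq])
  exact Equiv.ext fun i => congrFun this i

theorem perm_eq_one_of_lt_succ {n : ℕ} (x : Equiv.Perm (Fin n))
    (h : ∀ (i : ℕ) (hi : i + 1 < n), x ⟨i, Nat.lt_of_succ_lt hi⟩ < x ⟨i + 1, hi⟩) : x = 1 := by
  refine perm_eq_one_of_strictMono x ?_
  cases n with
  | zero => exact fun i => i.elim0
  | succ n => exact Fin.strictMono_iff_lt_succ.2 fun i => h i (by omega)

theorem exists_len_simpleRefl_mul_lt {σ : Sg r η} (hσ : σ ≠ 1) :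
    ∃ s : SimpleDat r η, len r η (simpleRefl s * σ) + 1 = len r η σ := by
  by_contra! hcon
  refine hσ (funext fun k => ?_)
  rw [Pi.one_apply, ← inv_eq_one]
  refine perm_eq_one_of_lt_succ _ fun i hi => ?_
  by_contra hlt
  refine hcon ⟨k, i, hi⟩ (len_simpleRefl_mul_of_gt ⟨k, i, hi⟩ σ
    (lt_of_le_of_ne (not_lt.1 hlt) fun h => ?_))
  exact lowIdx_ne_highIdx (⟨k, i, hi⟩ : SimpleDat r η) ((σ k)⁻¹.injective h).symm

theorem len_one : len r η 1 = 0 := by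
  refine Finset.sum_eq_zero fun k _ => Finset.card_eq_zero.2 (Finset.filter_eq_empty_iff.2 ?_)
  exact fun _ _ h => lt_asymm h.1 h.2

theorem eq_one_of_len_eq_zero {σ : Sg r η} (h : len r η σ = 0) : σ = 1 := by
  by_contra hσ
  obtain ⟨s, hs⟩ := exists_len_simpleRefl_mul_lt hσ
  omega

theorem len_simpleRefl (s : SimpleDat r η) : len r η (simpleRefl s) = 1 := by
  have h := len_simpleRefl_mul s 1
  rw [mul_one, len_one] at h
  omega

theorem len_inv (σ : Sg r η) : len r η σ⁻¹ = len r η σ := by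
  refine Finset.sum_congr rfl fun k _ => ?_
  refine Finset.card_bij (fun p _ => ((σ k)⁻¹ p.2, (σ k)⁻¹ p.1)) ?_ ?_ ?_
  · rintro ⟨a, b⟩ h
    simpa [and_comm] using h
  · rintro ⟨a, b⟩ _ ⟨c, d⟩ _ h
    simpa [and_comm] using h
  · rintro ⟨a, b⟩ h
    exact ⟨(σ k b, σ k a), by simpa [and_comm] using h, by simp⟩

theorem wEta_mul_self : wEta r η * wEta r η = 1 := by
  funext k
  ext i
  simp [wEta]

theorem wEta_inv : (wEta r η)⁻¹ = wEta r η := inv_eq_of_mul_eq_one_left wEta_mul_self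

theorem len_wEta : len r η (wEta r η) =
    ∑ k, (Finset.univ.filter fun p : Fin (η k) × Fin (η k) => p.1 < p.2).card := by
  simp [len, wEta]

theorem len_wEta_mul_add (σ : Sg r η) :
    len r η (wEta r η * σ) + len r η σ = len r η (wEta r η) := by
  rw [len_wEta, len, len, ← Finset.sum_add_distrib]
  refine Finset.sum_congr rfl fun k _ => ?_
  rw [← Finset.card_union_of_disjoint]
  · congr 1
    ext ⟨a, b⟩
    have : a < b → (σ k a < σ k b ∨ σ k b < σ k a) := fun h =>
      lt_or_gt_of_ne fun h' => h.ne ((σ k).injective h')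
    simp [wEta]
    tauto
  · rw [Finset.disjoint_filter]
    rintro ⟨a, b⟩ _ h h'
    simp only [Pi.mul_apply, wEta, Equiv.Perm.mul_apply, Fin.revPerm_apply, Fin.rev_lt_rev] at h
    exact lt_asymm h.2 h'.2

theorem len_le_len_wEta (σ : Sg r η) : len r η σ ≤ len r η (wEta r η) :=
  (Nat.le_add_left _ _).trans_eq (len_wEta_mul_add σ)

theorem eq_wEta_of_len_eq {σ : Sg r η} (h : len r η σ = len r η (wEta r η)) : σ = wEta r η := by
  have h1 : wEta r η * σ = 1 := eq_one_of_len_eq_zero (by have := len_wEta_mul_add σ; omega)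
  rw [← mul_one (wEta r η), ← h1, ← mul_assoc, wEta_mul_self, one_mul]

theorem len_inv_mul_wEta_add (σ : Sg r η) :
    len r η (σ⁻¹ * wEta r η) + len r η σ = len r η (wEta r η) := by
  rw [← len_wEta_mul_add σ, ← len_inv (wEta r η * σ), mul_inv_rev, wEta_inv]

theorem exists_isRed (σ : Sg r η) : ∃ w, IsRed r η σ w := by
  induction hn : len r η σ generalizing σ with
  | zero => exact ⟨[], by simp [IsRed, wordPerm, eq_one_of_len_eq_zero hn, len_one]⟩
  | succ n ih =>
    have hσ : σ ≠ 1 := by rintro rfl; simp [len_one] at hn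
    obtain ⟨s, hs⟩ := exists_len_simpleRefl_mul_lt hσ
    obtain ⟨w, hw, hl⟩ := ih (simpleRefl s * σ) (by omega)
    refine ⟨s :: w, ?_, by rw [List.length_cons, hl, hs]⟩
    change simpleRefl s * wordPerm r η w = σ
    rw [hw, simpleRefl_mul_cancel_left]

theorem sg_induction {p : Sg r η → Prop} (one : p 1)
    (mul : ∀ s σ, p σ → p (simpleRefl s * σ)) (σ : Sg r η) : p σ := by
  obtain ⟨w, rfl, -⟩ := exists_isRed σ
  induction w with
  | nil => exact one
  | cons s w ih => exact mul s _ ih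

end Length

section Action

variable {r : ℕ} {η : Fin r → ℕ}

theorem actP_X (σ : Sg r η) (p : Idx r η) :
    actP r η σ (MvPolynomial.X p) = MvPolynomial.X (permIdx r η σ p) := by
  simp [actP]

theorem actP_C (σ : Sg r η) (c : ℂ) : actP r η σ (MvPolynomial.C c) = MvPolynomial.C c := by
  simp [actP]

theorem actP_smul (σ : Sg r η) (c : ℂ) (p : Pol r η) : actP r η σ (c • p) = c • actP r η σ p := by
  rw [MvPolynomial.smul_eq_C_mul, map_mul, actP_C, MvPolynomial.smul_eq_C_mul]

theorem permIdx_one : permIdx r η 1 = 1 := rfl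

theorem permIdx_mul (σ τ : Sg r η) : permIdx r η (σ * τ) = permIdx r η σ * permIdx r η τ := rfl

theorem actP_mul (σ τ : Sg r η) (p : Pol r η) :
    actP r η (σ * τ) p = actP r η σ (actP r η τ p) := by
  simp [actP, permIdx_mul, MvPolynomial.rename_rename]

theorem actP_one (p : Pol r η) : actP r η 1 p = p := by
  simp [actP, permIdx_one]

theorem actF_algebraMap (σ : Sg r η) (p : Pol r η) :
    actF r η σ (algebraMap (Pol r η) (FF r η) p) = algebraMap (Pol r η) (FF r η) (actP r η σ p) :=
  IsFractionRing.ringEquivOfRingEquiv_algebraMap _ _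

theorem actF_mul (σ τ : Sg r η) (f : FF r η) :
    actF r η (σ * τ) f = actF r η σ (actF r η τ f) := by
  have : (actF r η (σ * τ) : FF r η →+* FF r η) =
      (actF r η σ : FF r η →+* FF r η).comp (actF r η τ : FF r η →+* FF r η) := by
    refine IsLocalization.ringHom_ext (nonZeroDivisors (Pol r η)) (RingHom.ext fun p => ?_)
    simp [actF_algebraMap, actP_mul]
  exact RingHom.congr_fun this f

theorem actF_one (f : FF r η) : actF r η 1 f = f := by
  have : (actF r η 1 : FF r η →+* FF r η) = RingHom.id _ := by
    refine IsLocalization.ringHom_ext (nonZeroDivisors (Pol r η)) (RingHom.ext fun p => ?_)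
    simp [actF_algebraMap, actP_one]
  exact RingHom.congr_fun this f

/-- The difference of the two variables exchanged by a simple transposition. -/
def root (s : SimpleDat r η) : Pol r η :=
  MvPolynomial.X (⟨s.1, lowIdx s⟩ : Idx r η) - MvPolynomial.X (⟨s.1, highIdx s⟩ : Idx r η)

theorem root_ne_zero (s : SimpleDat r η) : root s ≠ 0 := by
  rw [root, sub_ne_zero]
  intro h
  have := MvPolynomial.X_injective h
  simp at this

theorem algebraMap_root_ne_zero (s : SimpleDat r η) :
    algebraMap (Pol r η) (FF r η) (root s) ≠ 0 := by
  simpa using root_ne_zero s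

theorem permIdx_simpleRefl_low (s : SimpleDat r η) :
    permIdx r η (simpleRefl s) ⟨s.1, lowIdx s⟩ = ⟨s.1, highIdx s⟩ := by
  change (⟨s.1, simpleRefl s s.1 (lowIdx s)⟩ : Idx r η) = _
  rw [simpleRefl_apply_self, Equiv.swap_apply_left]

theorem permIdx_simpleRefl_high (s : SimpleDat r η) :
    permIdx r η (simpleRefl s) ⟨s.1, highIdx s⟩ = ⟨s.1, lowIdx s⟩ := by
  change (⟨s.1, simpleRefl s s.1 (highIdx s)⟩ : Idx r η) = _
  rw [simpleRefl_apply_self, Equiv.swap_apply_right]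

theorem permIdx_simpleRefl_of_ne (s : SimpleDat r η) {p : Idx r η}
    (hl : p ≠ ⟨s.1, lowIdx s⟩) (hh : p ≠ ⟨s.1, highIdx s⟩) :
    permIdx r η (simpleRefl s) p = p := by
  obtain ⟨k, i⟩ := p
  change (⟨k, simpleRefl s k i⟩ : Idx r η) = _
  by_cases hk : k = s.1
  · subst hk
    rw [simpleRefl_apply_self, Equiv.swap_apply_of_ne_of_ne]
    · rintro rfl; exact hl rfl
    · rintro rfl; exact hh rfl
  · rw [simpleRefl_apply_of_ne s hk, Equiv.Perm.one_apply]

theorem actP_simpleRefl_root (s : SimpleDat r η) : actP r η (simpleRefl s) (root s) = -root s := by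
  rw [root, map_sub, actP_X, actP_X, permIdx_simpleRefl_low, permIdx_simpleRefl_high, neg_sub]

theorem actF_simpleRefl_self (s : SimpleDat r η) (f : FF r η) :
    actF r η (simpleRefl s) (actF r η (simpleRefl s) f) = f := by
  rw [← actF_mul, simpleRefl_mul_self, actF_one]

/-- The divided difference operator attached to a simple transposition. -/
abbrev ddS (s : SimpleDat r η) (f : FF r η) : FF r η := dd r η s.1 s.2.1 s.2.2 f

theorem ddS_eq (s : SimpleDat r η) (f : FF r η) :
    ddS s f = (f - actF r η (simpleRefl s) f) / algebraMap (Pol r η) (FF r η) (root s) := by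
  rw [root, map_sub]
  rfl

theorem ddS_add (s : SimpleDat r η) (f g : FF r η) : ddS s (f + g) = ddS s f + ddS s g := by
  simp only [ddS_eq, map_add]
  ring

theorem ddS_mul_of_invariant (s : SimpleDat r η) {c : FF r η} (hc : actF r η (simpleRefl s) c = c)
    (f : FF r η) : ddS s (c * f) = c * ddS s f := by
  simp only [ddS_eq, map_mul, hc]
  ring

theorem ddS_zero (s : SimpleDat r η) : ddS s 0 = 0 := by
  simp [ddS_eq]

theorem ddS_actF (s : SimpleDat r η) (f : FF r η) :
    ddS s (actF r η (simpleRefl s) f) = -ddS s f := by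
  simp only [ddS_eq, actF_simpleRefl_self]
  ring

theorem ddS_eq_zero_iff (s : SimpleDat r η) (f : FF r η) :
    ddS s f = 0 ↔ actF r η (simpleRefl s) f = f := by
  rw [ddS_eq, div_eq_zero_iff, or_iff_left (algebraMap_root_ne_zero s), sub_eq_zero, eq_comm]

theorem ddS_ddS (s : SimpleDat r η) (f : FF r η) : ddS s (ddS s f) = 0 := by
  rw [ddS_eq_zero_iff, ddS_eq, map_div₀, map_sub, actF_simpleRefl_self, actF_algebraMap,
    actP_simpleRefl_root, map_neg, ← neg_sub f]
  exact neg_div_neg_eq _ _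

theorem ddS_algebraMap (s : SimpleDat r η) {p q : Pol r η}
    (h : p - actP r η (simpleRefl s) p = root s * q) :
    ddS s (algebraMap (Pol r η) (FF r η) p) = algebraMap (Pol r η) (FF r η) q := by
  rw [ddS_eq, actF_algebraMap, ← map_sub, h, map_mul, mul_div_cancel_left₀]
  exact algebraMap_root_ne_zero s

theorem actF_eq_self_of_simple {f : FF r η} (h : ∀ s, actF r η (simpleRefl s) f = f)
    (σ : Sg r η) : actF r η σ f = f := by
  refine sg_induction (p := fun σ => actF r η σ f = f) (actF_one f) (fun s τ hτ => ?_) σ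
  rw [actF_mul, hτ, h]

theorem ddWord_add (w : Word r η) (f g : FF r η) :
    ddWord r η w (f + g) = ddWord r η w f + ddWord r η w g := by
  induction w with
  | nil => rfl
  | cons s w ih =>
    change ddS s (ddWord r η w (f + g)) = ddS s _ + ddS s _
    rw [ih, ddS_add]
    rfl

theorem ddWord_mul_of_invariant (w : Word r η) {c : FF r η} (hc : ∀ σ, actF r η σ c = c)
    (f : FF r η) : ddWord r η w (c * f) = c * ddWord r η w f := by
  induction w with
  | nil => rfl
  | cons s w ih =>
    change ddS s (ddWord r η w (c * f)) = c * ddS s _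
    rw [ih, ddS_mul_of_invariant s (hc _)]
    rfl

theorem ddWord_append_singleton (w : Word r η) (s : SimpleDat r η) (f : FF r η) :
    ddWord r η (w ++ [s]) f = ddWord r η w (ddS s f) := by
  simp [ddWord]

theorem etaFact_eq_card : etaFact r η = Fintype.card (Sg r η) := by
  simp [etaFact, Fintype.card_perm]

theorem etaFact_ne_zero : (etaFact r η : FF r η) ≠ 0 := by
  rw [etaFact_eq_card, Nat.cast_ne_zero]
  exact Fintype.card_ne_zero

theorem symF_add (f g : FF r η) : symF r η (f + g) = symF r η f + symF r η g := by
  simp only [symF, map_add, Finset.sum_add_distrib, mul_add]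

theorem symF_sum {ι : Type*} (t : Finset ι) (f : ι → FF r η) :
    symF r η (∑ i ∈ t, f i) = ∑ i ∈ t, symF r η (f i) := by
  simp only [symF, map_sum, ← Finset.mul_sum]
  rw [Finset.sum_comm]

theorem symF_mul_of_invariant {c : FF r η} (hc : ∀ σ, actF r η σ c = c) (f : FF r η) :
    symF r η (c * f) = c * symF r η f := by
  simp only [symF, map_mul, hc, ← Finset.mul_sum]
  ring

theorem symF_eq_self {c : FF r η} (hc : ∀ σ, actF r η σ c = c) : symF r η c = c := by
  simp only [symF, hc, Finset.sum_const, Finset.card_univ, nsmul_eq_mul, ← etaFact_eq_card]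
  rw [inv_mul_cancel_left₀ etaFact_ne_zero]

theorem actF_symF (σ : Sg r η) (f : FF r η) : actF r η σ (symF r η f) = symF r η f := by
  simp only [symF, map_mul, map_inv₀, map_natCast, map_sum, ← actF_mul]
  congr 1
  exact Fintype.sum_equiv (Equiv.mulLeft σ) _ _ fun _ => rfl

end Action

section DividedDifferences

variable {r : ℕ} {η : Fin r → ℕ}

/-- A family of operators computing divided differences along reduced words. -/
def IsDividedDiff (Pd : Sg r η → FF r η → FF r η) : Prop :=
  ∀ (σ : Sg r η) (w : Word r η), IsRed r η σ w → ∀ f, Pd σ f = ddWord r η w f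

namespace IsDividedDiff

variable {Pd : Sg r η → FF r η → FF r η} (hPd : IsDividedDiff Pd)
include hPd

theorem add (σ : Sg r η) (f g : FF r η) : Pd σ (f + g) = Pd σ f + Pd σ g := by
  obtain ⟨w, hw⟩ := exists_isRed σ
  simp only [hPd σ w hw, ddWord_add]

theorem mul_of_invariant (σ : Sg r η) {c : FF r η} (hc : ∀ σ, actF r η σ c = c) (f : FF r η) :
    Pd σ (c * f) = c * Pd σ f := by
  obtain ⟨w, hw⟩ := exists_isRed σ
  simp only [hPd σ w hw, ddWord_mul_of_invariant w hc]

theorem sum {ι : Type*} (σ : Sg r η) (t : Finset ι) (f : ι → FF r η) :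
    Pd σ (∑ i ∈ t, f i) = ∑ i ∈ t, Pd σ (f i) :=
  map_sum (⟨⟨Pd σ, by simpa using hPd.add σ 0 0⟩, hPd.add σ⟩ : FF r η →+ FF r η) f t

theorem one (f : FF r η) : Pd 1 f = f :=
  hPd 1 [] ⟨rfl, len_one.symm⟩ f

theorem simpleRefl_mul {s : SimpleDat r η} {σ : Sg r η}
    (h : len r η (simpleRefl s * σ) = len r η σ + 1) (f : FF r η) :
    Pd (simpleRefl s * σ) f = ddS s (Pd σ f) := by
  obtain ⟨w, hw, hl⟩ := exists_isRed σ
  rw [hPd σ w ⟨hw, hl⟩, hPd _ (s :: w) ⟨?_, ?_⟩]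
  · rfl
  · rw [← hw]; rfl
  · rw [h, List.length_cons, hl]

theorem ddS_eq_zero {s : SimpleDat r η} {σ : Sg r η}
    (h : len r η (simpleRefl s * σ) + 1 = len r η σ) (f : FF r η) : ddS s (Pd σ f) = 0 := by
  have := hPd.simpleRefl_mul (s := s) (σ := simpleRefl s * σ)
    (by rw [simpleRefl_mul_cancel_left, h]) f
  rw [simpleRefl_mul_cancel_left] at this
  rw [this, ddS_ddS]

theorem ddWord_comp (w : Word r η) (τ : Sg r η) (f : FF r η) :
    ddWord r η w (Pd τ f) = if len r η (wordPerm r η w * τ) = w.length + len r η τ then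
      Pd (wordPerm r η w * τ) f else 0 := by
  induction w with
  | nil => simp [ddWord, wordPerm]
  | cons s w ih =>
    change ddS s (ddWord r η w (Pd τ f)) = _
    have hw : wordPerm r η (s :: w) * τ = simpleRefl s * (wordPerm r η w * τ) := by
      rw [← mul_assoc]; rfl
    have hle : len r η (wordPerm r η w * τ) ≤ w.length + len r η τ := by
      clear ih hw
      induction w with
      | nil => simp [wordPerm]
      | cons t w ih =>
        have hw : wordPerm r η (t :: w) * τ = simpleRefl t * (wordPerm r η w * τ) := by
          rw [← mul_assoc]; rfl
        have := len_simpleRefl_mul t (wordPerm r η w * τ)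
        rw [hw, List.length_cons]
        omega
    rw [ih, hw, List.length_cons]
    rcases len_simpleRefl_mul s (wordPerm r η w * τ) with h | h
    · by_cases h' : len r η (wordPerm r η w * τ) = w.length + len r η τ
      · rw [if_pos h', if_pos (by omega), hPd.simpleRefl_mul h]
      · rw [if_neg h', if_neg (by omega), ddS_zero]
    · rw [if_neg (c := len r η (simpleRefl s * (wordPerm r η w * τ)) = _) (by omega)]
      split_ifs
      · exact hPd.ddS_eq_zero h f
      · exact ddS_zero s

theorem comp (σ τ : Sg r η) (f : FF r η) :
    Pd σ (Pd τ f) = if len r η (σ * τ) = len r η σ + len r η τ then Pd (σ * τ) f else 0 := by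
  obtain ⟨w, rfl, hl⟩ := exists_isRed σ
  rw [hPd _ w ⟨rfl, hl⟩, hPd.ddWord_comp, hl]

theorem eq_wEta_of_ddWord_ne_zero {w : Word r η} (hl : w.length = len r η (wEta r η))
    {f : FF r η} (hf : ddWord r η w f ≠ 0) : Pd (wEta r η) f = ddWord r η w f := by
  have h := hPd.ddWord_comp w 1 f
  rw [hPd.one, mul_one, len_one, add_zero] at h
  split_ifs at h with hw
  · rw [h, eq_wEta_of_len_eq (hw.trans hl)]
  · exact absurd h hf

theorem wEta_simpleRefl (s : SimpleDat r η) (f : FF r η) :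
    Pd (wEta r η) (actF r η (simpleRefl s) f) = -Pd (wEta r η) f := by
  have hs (g : FF r η) : Pd (simpleRefl s) g = ddS s g := by
    have := hPd.simpleRefl_mul (s := s) (σ := 1)
      (by rw [mul_one, len_one, len_simpleRefl]) g
    rwa [mul_one, hPd.one] at this
  have hw (g : FF r η) : Pd (wEta r η) g = Pd (wEta r η * simpleRefl s) (ddS s g) := by
    have hl := len_wEta_mul_add (simpleRefl s)
    rw [← hs, hPd.comp, mul_assoc, simpleRefl_mul_self, mul_one, if_pos hl.symm]
  have hneg (g : FF r η) : Pd (wEta r η * simpleRefl s) (-g) =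
      -Pd (wEta r η * simpleRefl s) g := by
    rw [← neg_one_mul, hPd.mul_of_invariant _ (by simp), neg_one_mul]
  rw [hw, ddS_actF, hneg, ← hw]

theorem wEta_actF (σ : Sg r η) (f : FF r η) :
    Pd (wEta r η) (actF r η σ f) = (∏ k, ((Equiv.Perm.sign (σ k) : ℤ) : FF r η)) *
      Pd (wEta r η) f := by
  refine sg_induction (p := fun σ => Pd (wEta r η) (actF r η σ f) =
    (∏ k, ((Equiv.Perm.sign (σ k) : ℤ) : FF r η)) * Pd (wEta r η) f) ?_ (fun s τ h => ?_) σ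
  · simp [actF_one]
  · rw [actF_mul, hPd.wEta_simpleRefl, h, ← neg_one_mul, ← mul_assoc]
    congr 1
    simp only [Pi.mul_apply, map_mul, Units.val_mul, Int.cast_mul, Finset.prod_mul_distrib]
    congr 1
    rw [Finset.prod_eq_single s.1]
    · rw [simpleRefl_apply_self, Equiv.Perm.sign_swap (lowIdx_ne_highIdx s)]
      simp
    · intro k _ hk
      simp [simpleRefl_apply_of_ne s hk]
    · simp

theorem eq_zero_of_symF_eq_zero {f : FF r η} (h : ∀ σ, symF r η (Pd σ f) = 0) : f = 0 := by
  suffices H : ∀ n, ∀ σ, len r η σ + n = len r η (wEta r η) → Pd σ f = 0 by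
    rw [← hPd.one f]
    exact H _ 1 (by rw [len_one, zero_add])
  intro n
  induction n using Nat.strong_induction_on with
  | _ n ih =>
    intro σ hσ
    rw [← h σ, symF_eq_self]
    refine actF_eq_self_of_simple fun s => ?_
    rw [← ddS_eq_zero_iff]
    rcases len_simpleRefl_mul s σ with hs | hs
    · have := len_le_len_wEta (simpleRefl s * σ)
      rw [← hPd.simpleRefl_mul hs]
      exact ih (n - 1) (by omega) _ (by omega)
    · exact hPd.ddS_eq_zero hs f

end IsDividedDiff

end DividedDifferences

section Filtration

variable {r : ℕ} {η : Fin r → ℕ}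

variable (r η) in
/-- The linear forms spanned by the differences of two variables of the same block. -/
def diffSpan : Submodule ℂ (Pol r η) :=
  Submodule.span ℂ {q | ∃ (k : Fin r) (i j : Fin (η k)),
    q = MvPolynomial.X (⟨k, i⟩ : Idx r η) - MvPolynomial.X (⟨k, j⟩ : Idx r η)}

theorem X_sub_X_mem_diffSpan (k : Fin r) (i j : Fin (η k)) :
    (MvPolynomial.X (⟨k, i⟩ : Idx r η) - MvPolynomial.X (⟨k, j⟩ : Idx r η) : Pol r η) ∈
      diffSpan r η :=
  Submodule.subset_span ⟨k, i, j, rfl⟩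

theorem actP_mem_diffSpan (σ : Sg r η) {p : Pol r η} (hp : p ∈ diffSpan r η) :
    actP r η σ p ∈ diffSpan r η := by
  induction hp using Submodule.span_induction with
  | mem x hx =>
    obtain ⟨k, i, j, rfl⟩ := hx
    rw [map_sub, actP_X, actP_X]
    exact X_sub_X_mem_diffSpan k _ _
  | zero => rw [map_zero]; exact zero_mem _
  | add x y _ _ hx hy => rw [map_add]; exact add_mem hx hy
  | smul c x _ hx => rw [actP_smul]; exact Submodule.smul_mem _ _ hx

theorem actP_mem_diffSpan_pow (σ : Sg r η) {n : ℕ} {p : Pol r η} (hp : p ∈ diffSpan r η ^ n) :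
    actP r η σ p ∈ diffSpan r η ^ n := by
  induction n generalizing p with
  | zero =>
    rw [pow_zero, Submodule.mem_one] at hp ⊢
    obtain ⟨c, rfl⟩ := hp
    exact ⟨c, (actP_C σ c).symm⟩
  | succ n ih =>
    rw [pow_succ] at hp ⊢
    induction hp using Submodule.mul_induction_on' with
    | mem_mul_mem x hx y hy =>
      rw [map_mul]
      exact Submodule.mul_mem_mul (ih hx) (actP_mem_diffSpan σ hy)
    | add x _ y _ hx hy => rw [map_add]; exact add_mem hx hy

theorem isHomogeneous_of_mem_diffSpan_pow {n : ℕ} {p : Pol r η} (hp : p ∈ diffSpan r η ^ n) :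
    p.IsHomogeneous n := by
  have h1 : diffSpan r η ≤ MvPolynomial.homogeneousSubmodule (Idx r η) ℂ 1 := by
    refine Submodule.span_le.2 ?_
    rintro _ ⟨k, i, j, rfl⟩
    exact (MvPolynomial.isHomogeneous_X _ _).sub (MvPolynomial.isHomogeneous_X _ _)
  induction n generalizing p with
  | zero =>
    rw [pow_zero, Submodule.mem_one] at hp
    obtain ⟨c, rfl⟩ := hp
    exact MvPolynomial.isHomogeneous_C _ _
  | succ n ih =>
    rw [pow_succ] at hp
    induction hp using Submodule.mul_induction_on' with
    | mem_mul_mem x hx y hy => exact (ih hx).mul (h1 hy)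
    | add x _ y _ hx hy => exact hx.add hy

theorem mem_pIdeal_of_mem_diffSpan {p : Pol r η} (hp : p ∈ diffSpan r η) : p ∈ pIdeal r η := by
  suffices h : diffSpan r η ≤ (pIdeal r η).restrictScalars ℂ from h hp
  refine Submodule.span_le.2 ?_
  rintro _ ⟨k, i, j, rfl⟩
  rcases lt_trichotomy i j with h | rfl | h
  · exact Ideal.subset_span ⟨k, i, j, h, rfl⟩
  · rw [sub_self]; exact zero_mem _
  · rw [← neg_sub]
    exact neg_mem (Ideal.subset_span (α := Pol r η) ⟨k, j, i, h, rfl⟩)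

theorem mem_pIdeal_of_mem_diffSpan_pow {n : ℕ} (hn : n ≠ 0) {p : Pol r η}
    (hp : p ∈ diffSpan r η ^ n) : p ∈ pIdeal r η := by
  obtain ⟨n, rfl⟩ := Nat.exists_eq_succ_of_ne_zero hn
  rw [pow_succ] at hp
  induction hp using Submodule.mul_induction_on' with
  | mem_mul_mem x hx y hy => exact Ideal.mul_mem_left _ _ (mem_pIdeal_of_mem_diffSpan hy)
  | add x _ y _ hx hy => exact add_mem hx hy

theorem exists_X_sub_actP_eq (s : SimpleDat r η) (p : Idx r η) :
    ∃ c : ℂ, (MvPolynomial.X p : Pol r η) - actP r η (simpleRefl s) (MvPolynomial.X p) =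
      root s * MvPolynomial.C c := by
  rw [actP_X]
  by_cases hl : p = ⟨s.1, lowIdx s⟩
  · refine ⟨1, ?_⟩
    rw [hl, permIdx_simpleRefl_low, map_one, mul_one, root]
  by_cases hh : p = ⟨s.1, highIdx s⟩
  · refine ⟨-1, ?_⟩
    rw [hh, permIdx_simpleRefl_high, map_neg, map_one, mul_neg_one, root, neg_sub]
  · exact ⟨0, by rw [permIdx_simpleRefl_of_ne s hl hh]; simp⟩

theorem exists_sub_actP_eq_of_mem_diffSpan (s : SimpleDat r η) {p : Pol r η}
    (hp : p ∈ diffSpan r η) :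
    ∃ c : ℂ, p - actP r η (simpleRefl s) p = root s * MvPolynomial.C c := by
  induction hp using Submodule.span_induction with
  | mem x hx =>
    obtain ⟨k, i, j, rfl⟩ := hx
    obtain ⟨c, hc⟩ := exists_X_sub_actP_eq s ⟨k, i⟩
    obtain ⟨d, hd⟩ := exists_X_sub_actP_eq s ⟨k, j⟩
    refine ⟨c - d, ?_⟩
    rw [map_sub, map_sub, mul_sub, ← hc, ← hd]
    ring
  | zero => exact ⟨0, by simp⟩
  | add x y _ _ hx hy =>
    obtain ⟨c, hc⟩ := hx
    obtain ⟨d, hd⟩ := hy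
    refine ⟨c + d, ?_⟩
    rw [map_add, map_add, mul_add, ← hc, ← hd]
    ring
  | smul a x _ hx =>
    obtain ⟨c, hc⟩ := hx
    refine ⟨a * c, ?_⟩
    rw [actP_smul, ← smul_sub, hc, map_mul, MvPolynomial.smul_eq_C_mul]
    ring

theorem exists_sub_actP_eq_of_mem_diffSpan_pow (s : SimpleDat r η) {n : ℕ} {p : Pol r η}
    (hp : p ∈ diffSpan r η ^ (n + 1)) :
    ∃ q ∈ diffSpan r η ^ n, p - actP r η (simpleRefl s) p = root s * q := by
  induction n generalizing p with
  | zero =>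
    rw [zero_add, pow_one] at hp
    obtain ⟨c, hc⟩ := exists_sub_actP_eq_of_mem_diffSpan s hp
    exact ⟨_, Submodule.mem_one.2 ⟨c, rfl⟩, hc⟩
  | succ n ih =>
    rw [pow_succ] at hp
    induction hp using Submodule.mul_induction_on' with
    | mem_mul_mem x hx y hy =>
      obtain ⟨q, hq, hxq⟩ := ih hx
      obtain ⟨c, hc⟩ := exists_sub_actP_eq_of_mem_diffSpan s hy
      refine ⟨q * y + c • actP r η (simpleRefl s) x, add_mem ?_ ?_, ?_⟩
      · rw [pow_succ]
        exact Submodule.mul_mem_mul hq hy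
      · exact Submodule.smul_mem _ _ (actP_mem_diffSpan_pow _ hx)
      · rw [map_mul, mul_add, ← mul_assoc, ← hxq, MvPolynomial.smul_eq_C_mul, ← mul_assoc, ← hc]
        ring
    | add x _ y _ hx hy =>
      obtain ⟨q, hq, hxq⟩ := hx
      obtain ⟨q', hq', hyq⟩ := hy
      refine ⟨q + q', add_mem hq hq', ?_⟩
      rw [map_add, mul_add, ← hxq, ← hyq]
      ring

theorem exists_ddWord_eq (w : Word r η) {n : ℕ} {p : Pol r η}
    (hp : p ∈ diffSpan r η ^ (n + w.length)) :
    ∃ q ∈ diffSpan r η ^ n,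
      ddWord r η w (algebraMap (Pol r η) (FF r η) p) = algebraMap (Pol r η) (FF r η) q := by
  induction w generalizing n with
  | nil => exact ⟨p, hp, rfl⟩
  | cons s w ih =>
    rw [List.length_cons, add_comm w.length 1, ← add_assoc] at hp
    obtain ⟨q, hq, h⟩ := ih hp
    obtain ⟨q', hq', h'⟩ := exists_sub_actP_eq_of_mem_diffSpan_pow s hq
    refine ⟨q', hq', ?_⟩
    change ddS s (ddWord r η w _) = _
    rw [h, ddS_algebraMap s h']

theorem algebraMap_C_inv_etaFact :
    algebraMap (Pol r η) (FF r η) (MvPolynomial.C (etaFact r η : ℂ)⁻¹) =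
      (etaFact r η : FF r η)⁻¹ := by
  refine eq_inv_of_mul_eq_one_left ?_
  rw [← map_natCast (algebraMap (Pol r η) (FF r η)), ← map_natCast MvPolynomial.C, ← map_mul,
    ← map_mul, inv_mul_cancel₀, map_one, map_one]
  have := etaFact_ne_zero (r := r) (η := η)
  rw [Nat.cast_ne_zero] at this ⊢
  exact this

theorem exists_symF_eq {n : ℕ} {p : Pol r η} (hp : p ∈ diffSpan r η ^ n) :
    ∃ q ∈ diffSpan r η ^ n, (∀ σ, actP r η σ q = q) ∧
      symF r η (algebraMap (Pol r η) (FF r η) p) = algebraMap (Pol r η) (FF r η) q := by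
  have h : symF r η (algebraMap (Pol r η) (FF r η) p) = algebraMap (Pol r η) (FF r η)
      ((etaFact r η : ℂ)⁻¹ • ∑ σ : Sg r η, actP r η σ p) := by
    rw [MvPolynomial.smul_eq_C_mul, map_mul, algebraMap_C_inv_etaFact, symF, map_sum]
    simp only [actF_algebraMap]
  refine ⟨_, Submodule.smul_mem _ _ (Submodule.sum_mem _ fun σ _ =>
    actP_mem_diffSpan_pow σ hp), fun σ => ?_, h⟩
  refine IsFractionRing.injective (Pol r η) (FF r η) ?_
  rw [← actF_algebraMap, ← h, actF_symF]

theorem prod_mem_pow_sum {ι R A : Type*} [CommSemiring R] [CommSemiring A] [Algebra R A]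
    (V : Submodule R A) (t : Finset ι) (f : ι → A) (d : ι → ℕ) (h : ∀ i ∈ t, f i ∈ V ^ d i) :
    ∏ i ∈ t, f i ∈ V ^ ∑ i ∈ t, d i := by
  classical
  induction t using Finset.induction_on with
  | empty =>
    rw [Finset.prod_empty, Finset.sum_empty, pow_zero]
    exact Submodule.mem_one.2 ⟨1, map_one _⟩
  | insert a t ha ih =>
    rw [Finset.prod_insert ha, Finset.sum_insert ha, pow_add]
    exact Submodule.mul_mem_mul (h a (Finset.mem_insert_self a t))
      (ih fun i hi => h i (Finset.mem_insert_of_mem hi))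

theorem DeltaP_mem_diffSpan_pow : DeltaP r η ∈ diffSpan r η ^ len r η (wEta r η) := by
  rw [len_wEta, DeltaP]
  refine prod_mem_pow_sum _ _ _ _ fun k _ => ?_
  rw [Finset.card_eq_sum_ones]
  refine prod_mem_pow_sum _ _ _ _ fun p _ => ?_
  rw [pow_one]
  exact X_sub_X_mem_diffSpan k p.1 p.2

end Filtration

section Vandermonde

variable {r : ℕ} {η : Fin r → ℕ}

variable (r η) in
/-- The monomial with exponents `e`. -/
def monomialP (e : Fin r → ℕ → ℕ) : Pol r η :=
  ∏ k, ∏ i : Fin (η k), MvPolynomial.X (⟨k, i⟩ : Idx r η) ^ e k i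

theorem monomialP_eq_prod (e : Fin r → ℕ → ℕ) :
    monomialP r η e = ∏ p : Idx r η, MvPolynomial.X p ^ e p.1 p.2 := by
  rw [Fintype.prod_sigma]
  rfl

theorem prod_sub_eq_sum_sign {R : Type*} [CommRing R] {n : ℕ} (v : Fin n → R) :
    ∏ p ∈ Finset.univ.filter (fun p : Fin n × Fin n => p.1 < p.2), (v p.1 - v p.2) =
      ∑ x : Equiv.Perm (Fin n),
        ((Equiv.Perm.sign x : ℤ) : R) * ∏ i, v (x i) ^ (n - 1 - (i : ℕ)) := by
  have h := Matrix.det_projVandermonde (fun _ => (1 : R)) v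
  rw [Matrix.det_apply'] at h
  simp only [Matrix.projVandermonde_apply, one_pow, one_mul] at h
  rw [Finset.prod_filter, Fintype.prod_prod_type]
  simp only [← Finset.prod_filter]
  convert h.symm using 3 with i _ x
  · ext j; simp
  · refine Finset.prod_congr rfl fun i _ => ?_
    congr 1
    rw [Fin.val_rev]
    omega

variable (r η) in
/-- The exponents of the leading monomial of the Vandermonde product. -/
def staircase (k : Fin r) (i : ℕ) : ℕ := η k - 1 - i

theorem DeltaP_eq_sum : DeltaP r η = ∑ σ : Sg r η,
    (∏ k, ((Equiv.Perm.sign (σ k) : ℤ) : Pol r η)) *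
      actP r η σ (monomialP r η (staircase r η)) := by
  rw [DeltaP]
  simp only [prod_sub_eq_sum_sign fun i => (MvPolynomial.X (⟨_, i⟩ : Idx r η) : Pol r η)]
  rw [Finset.prod_univ_sum, Fintype.piFinset_univ]
  refine Finset.sum_congr rfl fun σ _ => ?_
  simp only [Finset.prod_mul_distrib, monomialP, map_prod, map_pow, actP_X]
  rfl

theorem sum_staircase : ∑ k, ∑ i : Fin (η k), staircase r η k i = len r η (wEta r η) := by
  rw [len_wEta]
  refine Finset.sum_congr rfl fun k _ => ?_
  rw [Finset.card_filter, Fintype.sum_prod_type]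
  refine Finset.sum_congr rfl fun i _ => ?_
  rw [← Finset.card_filter, Finset.filter_lt_eq_Ioi, Fin.card_Ioi]
  rfl

theorem ddS_monomialP (s : SimpleDat r η) (e : Fin r → ℕ → ℕ)
    (h : e s.1 s.2.1 = e s.1 (s.2.1 + 1)) :
    ddS s (algebraMap (Pol r η) (FF r η)
      (MvPolynomial.X (⟨s.1, lowIdx s⟩ : Idx r η) * monomialP r η e)) =
      algebraMap (Pol r η) (FF r η) (monomialP r η e) := by
  refine ddS_algebraMap s ?_
  have hinv : actP r η (simpleRefl s) (monomialP r η e) = monomialP r η e := by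
    rw [monomialP_eq_prod, map_prod]
    refine Fintype.prod_equiv (permIdx r η (simpleRefl s)) _ _ fun p => ?_
    rw [map_pow, actP_X]
    by_cases hl : p = ⟨s.1, lowIdx s⟩
    · rw [hl, permIdx_simpleRefl_low]
      exact congrArg _ h
    by_cases hh : p = ⟨s.1, highIdx s⟩
    · rw [hh, permIdx_simpleRefl_high]
      exact congrArg _ h.symm
    · rw [permIdx_simpleRefl_of_ne s hl hh]
  rw [map_mul, hinv, actP_X, permIdx_simpleRefl_low, ← sub_mul, root]

/-- A weakly decreasing exponent vector with steps of size at most one, vanishing at the end of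
each block, is reduced to zero by a suitable chain of divided differences. -/
theorem exists_ddWord_monomialP_eq_one (n : ℕ) (e : Fin r → ℕ → ℕ)
    (hle : ∀ k i, e k (i + 1) ≤ e k i) (hge : ∀ k i, e k i ≤ e k (i + 1) + 1)
    (hend : ∀ k i, η k ≤ i + 1 → e k i = 0) (hn : ∑ k, ∑ i : Fin (η k), e k i = n) :
    ∃ w : Word r η, w.length = n ∧
      ddWord r η w (algebraMap (Pol r η) (FF r η) (monomialP r η e)) = 1 := by
  induction n generalizing e with
  | zero =>
    refine ⟨[], rfl, ?_⟩
    simp only [Finset.sum_eq_zero_iff, Finset.mem_univ, true_imp_iff] at hn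
    simp [ddWord, monomialP, hn]
  | succ n ih =>
    obtain ⟨k, -, hk⟩ := Finset.exists_ne_zero_of_sum_ne_zero (hn.trans_ne n.succ_ne_zero)
    obtain ⟨j, -, hj⟩ := Finset.exists_ne_zero_of_sum_ne_zero hk
    have hdrop : ∃ i, e k (i + 1) < e k i := by
      by_contra! hcon
      have hconst (d : ℕ) : e k (j + d) = e k j := by
        induction d with
        | zero => rfl
        | succ d ihd => exact (le_antisymm (hle k _) (hcon _)).trans ihd
      exact hj ((hconst (η k)).symm.trans (hend k _ (by omega)))
    classical
    let i := Nat.find hdrop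
    have hi : e k (i + 1) < e k i := Nat.find_spec hdrop
    have hmin : ∀ l < i, e k l ≤ e k (l + 1) := fun l hl => not_lt.1 (Nat.find_min hdrop hl)
    have hik : i + 1 < η k := by
      by_contra hcon
      have := hend k i (by omega)
      omega
    let s : SimpleDat r η := ⟨k, i, hik⟩
    let e' : Fin r → ℕ → ℕ := fun k' l => if k' = k ∧ l = i then e k' l - 1 else e k' l
    have hmon : monomialP r η e =
        MvPolynomial.X (⟨s.1, lowIdx s⟩ : Idx r η) * monomialP r η e' := by
      rw [monomialP_eq_prod, monomialP_eq_prod,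
        ← Finset.mul_prod_erase _ _ (Finset.mem_univ (⟨s.1, lowIdx s⟩ : Idx r η)),
        ← Finset.mul_prod_erase _ _ (Finset.mem_univ (⟨s.1, lowIdx s⟩ : Idx r η)), ← mul_assoc,
        ← pow_succ']
      congr 1
      · congr 1
        simp only [s, e', and_self, if_true]
        omega
      · refine Finset.prod_congr rfl fun p hp => ?_
        congr 1
        have : ¬ (p.1 = k ∧ (p.2 : ℕ) = i) := by
          rintro ⟨rfl, h⟩
          exact Finset.ne_of_mem_erase hp (Sigma.ext rfl (heq_of_eq (Fin.ext h)))
        simp only [e', if_neg this]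
    have h_sum : ∑ k, ∑ i : Fin (η k), e' k i = n := by
      rw [← Fintype.sum_sigma'] at hn ⊢
      rw [← Finset.add_sum_erase _ _ (Finset.mem_univ (⟨s.1, lowIdx s⟩ : Idx r η))] at hn ⊢
      have : ∑ p ∈ Finset.univ.erase (⟨s.1, lowIdx s⟩ : Idx r η), e' p.1 p.2 =
          ∑ p ∈ Finset.univ.erase (⟨s.1, lowIdx s⟩ : Idx r η), e p.1 p.2 := by
        refine Finset.sum_congr rfl fun p hp => ?_
        have : ¬ (p.1 = k ∧ (p.2 : ℕ) = i) := by
          rintro ⟨rfl, h⟩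
          exact Finset.ne_of_mem_erase hp (Sigma.ext rfl (heq_of_eq (Fin.ext h)))
        simp only [e', if_neg this]
      rw [this]
      simp only [s, e', and_self, if_true] at hn ⊢
      omega
    have hle' : ∀ k' l, e' k' (l + 1) ≤ e' k' l := by
      intro k' l
      have := hle k' l
      simp only [e']
      split_ifs with h1 h2 h2
      · omega
      · omega
      · obtain ⟨rfl, rfl⟩ := h2
        omega
      · omega
    have hge' : ∀ k' l, e' k' l ≤ e' k' (l + 1) + 1 := by
      intro k' l
      have := hge k' l
      simp only [e']
      split_ifs with h1 h2 h2
      · omega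
      · omega
      · obtain ⟨rfl, h⟩ := h2
        have := hmin l (by omega)
        omega
      · omega
    have hend' : ∀ k' l, η k' ≤ l + 1 → e' k' l = 0 := by
      intro k' l h
      have := hend k' l h
      simp only [e']
      split_ifs <;> omega
    obtain ⟨w, hw, h1⟩ := ih e' hle' hge' hend' h_sum
    refine ⟨w ++ [s], by simp [hw], ?_⟩
    rw [ddWord_append_singleton, hmon, ddS_monomialP, h1]
    have := hge k i
    simp only [s, e', and_self, if_true, Nat.succ_ne_self, and_false, if_false]
    omega

end Vandermonde

section DualBasis

variable {r : ℕ} {η : Fin r → ℕ}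

/-- The family whose expansion in the dual basis is unitriangular. -/
def scaledDelta (Pd : Sg r η → FF r η → FF r η) (τ : Sg r η) : FF r η :=
  (etaFact r η : FF r η)⁻¹ * Pd (τ⁻¹ * wEta r η) (DeltaF r η)

/-- The elements of `F` which are polynomials in a power of the space of differences. -/
def diffPow (r : ℕ) (η : Fin r → ℕ) (n : ℕ) : AddSubgroup (FF r η) :=
  (diffSpan r η ^ n).toAddSubgroup.map (algebraMap (Pol r η) (FF r η)).toAddMonoidHom

namespace IsDividedDiff

variable {Pd : Sg r η → FF r η → FF r η} (hPd : IsDividedDiff Pd)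
include hPd

theorem symF_sum_mul {ι : Type*} (ρ : Sg r η) (t : Finset ι) (c f : ι → FF r η)
    (hc : ∀ i ∈ t, ∀ σ, actF r η σ (c i) = c i) :
    symF r η (Pd ρ (∑ i ∈ t, c i * f i)) = ∑ i ∈ t, c i * symF r η (Pd ρ (f i)) := by
  rw [hPd.sum, symF_sum]
  refine Finset.sum_congr rfl fun i hi => ?_
  rw [hPd.mul_of_invariant ρ (hc i hi), symF_mul_of_invariant (hc i hi)]

theorem mem_diffPow {n : ℕ} {σ : Sg r η} {f : FF r η} (hf : f ∈ diffPow r η (n + len r η σ)) :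
    Pd σ f ∈ diffPow r η n := by
  obtain ⟨p, hp, rfl⟩ := hf
  obtain ⟨w, hw⟩ := exists_isRed σ
  rw [← hw.2] at hp
  obtain ⟨q, hq, h⟩ := exists_ddWord_eq w hp
  exact ⟨q, hq, ((hPd σ w hw _).trans h).symm⟩

theorem wEta_DeltaF : Pd (wEta r η) (DeltaF r η) = etaFact r η := by
  have hmono : Pd (wEta r η)
      (algebraMap (Pol r η) (FF r η) (monomialP r η (staircase r η))) = 1 := by
    obtain ⟨w, hw, h1⟩ := exists_ddWord_monomialP_eq_one _ (staircase r η)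
      (fun k i => by simp only [staircase]; omega) (fun k i => by simp only [staircase]; omega)
      (fun k i h => by simp only [staircase]; omega) sum_staircase
    rw [hPd.eq_wEta_of_ddWord_ne_zero hw (h1.trans_ne one_ne_zero), h1]
  rw [DeltaF, DeltaP_eq_sum, map_sum, hPd.sum, etaFact_eq_card, Fintype.card_eq_sum_ones,
    Nat.cast_sum]
  refine Finset.sum_congr rfl fun σ _ => ?_
  simp only [map_mul, map_prod, map_intCast, ← actF_algebraMap]
  rw [hPd.mul_of_invariant _ (by simp), hPd.wEta_actF, hmono, mul_one, ← Finset.prod_mul_distrib,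
    Nat.cast_one]
  refine Finset.prod_eq_one fun k _ => ?_
  rw [← Int.cast_mul, ← Units.val_mul, Int.units_mul_self, Units.val_one, Int.cast_one]

theorem scaledDelta_mem (τ : Sg r η) : scaledDelta Pd τ ∈ diffPow r η (len r η τ) := by
  have h : DeltaF r η ∈ diffPow r η (len r η τ + len r η (τ⁻¹ * wEta r η)) := by
    rw [add_comm, len_inv_mul_wEta_add]
    exact ⟨_, DeltaP_mem_diffSpan_pow, rfl⟩
  obtain ⟨q, hq, h⟩ := hPd.mem_diffPow h
  refine ⟨_, Submodule.smul_mem _ (etaFact r η : ℂ)⁻¹ hq, ?_⟩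
  rw [scaledDelta, ← h, ← algebraMap_C_inv_etaFact, MvPolynomial.smul_eq_C_mul]
  exact map_mul (algebraMap (Pol r η) (FF r η)) _ _

theorem apply_scaledDelta (σ τ : Sg r η) : Pd σ (scaledDelta Pd τ) = (etaFact r η : FF r η)⁻¹ *
    if len r η (σ * (τ⁻¹ * wEta r η)) = len r η σ + len r η (τ⁻¹ * wEta r η) then
      Pd (σ * (τ⁻¹ * wEta r η)) (DeltaF r η) else 0 := by
  rw [scaledDelta, hPd.mul_of_invariant _ (by simp), hPd.comp]

theorem symF_scaledDelta_self (σ : Sg r η) : symF r η (Pd σ (scaledDelta Pd σ)) = 1 := by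
  rw [hPd.apply_scaledDelta, if_pos, mul_inv_cancel_left, hPd.wEta_DeltaF,
    inv_mul_cancel₀ etaFact_ne_zero, symF_eq_self (by simp)]
  rw [mul_inv_cancel_left, add_comm, len_inv_mul_wEta_add]

theorem symF_scaledDelta_of_ne {σ τ : Sg r η} (hne : σ ≠ τ) (hlen : ¬ len r η σ < len r η τ) :
    symF r η (Pd σ (scaledDelta Pd τ)) = 0 := by
  rw [hPd.apply_scaledDelta, if_neg, mul_zero, symF_eq_self (by simp)]
  intro h
  have h1 := len_inv_mul_wEta_add τ
  have h2 := len_le_len_wEta (σ * (τ⁻¹ * wEta r η))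
  have h3 : σ * (τ⁻¹ * wEta r η) = wEta r η := eq_wEta_of_len_eq (by omega)
  rw [← mul_assoc, mul_eq_right, mul_inv_eq_one] at h3
  exact hne h3

theorem exists_symF_scaledDelta_eq {σ τ : Sg r η} (hlen : len r η σ < len r η τ) :
    ∃ q ∈ diffSpan r η ^ (len r η τ - len r η σ), (∀ ρ, actP r η ρ q = q) ∧
      symF r η (Pd σ (scaledDelta Pd τ)) = algebraMap (Pol r η) (FF r η) q := by
  have h := hPd.scaledDelta_mem τ
  rw [← Nat.sub_add_cancel hlen.le] at h
  obtain ⟨p, hp, h⟩ := hPd.mem_diffPow h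
  rw [← h]
  exact exists_symF_eq hp

theorem sum_symF_scaledDelta_mul (P : Sg r η → FF r η) (τ : Sg r η) :
    ∑ σ, symF r η (Pd σ (scaledDelta Pd τ)) * P σ = P τ +
      ∑ σ ∈ Finset.univ.filter (fun σ => len r η σ < len r η τ),
        symF r η (Pd σ (scaledDelta Pd τ)) * P σ := by
  rw [← Finset.sum_filter_not_add_sum_filter _ fun σ => len r η σ < len r η τ]
  congr 1
  rw [Finset.sum_eq_single_of_mem τ (by simp), hPd.symF_scaledDelta_self, one_mul]
  intro σ hσ hne
  rw [hPd.symF_scaledDelta_of_ne hne (Finset.mem_filter.1 hσ).2, zero_mul]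

omit hPd in
theorem exists_triangular_solution (M : Sg r η → Sg r η → FF r η) (Q : Sg r η → FF r η) :
    ∃ P : Sg r η → FF r η, ∀ τ, Q τ = P τ +
      ∑ σ ∈ Finset.univ.filter (fun σ => len r η σ < len r η τ), M σ τ * P σ := by
  have wf := InvImage.wf (len r η) Nat.lt_wfRel.wf
  refine ⟨wf.fix fun τ rec => Q τ -
    ∑ σ : {σ // len r η σ < len r η τ}, M σ.1 τ * rec σ.1 σ.2, fun τ => ?_⟩
  rw [wf.fix_eq]
  rw [← sub_eq_iff_eq_add, sub_right_inj]
  exact Finset.sum_subtype _ (by simp) _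

theorem exists_expansion : ∃ P : Sg r η → FF r η,
    ∀ f, f = ∑ σ, symF r η (Pd σ f) * P σ := by
  obtain ⟨P, hP⟩ := exists_triangular_solution
    (fun σ τ => symF r η (Pd σ (scaledDelta Pd τ))) (scaledDelta Pd)
  have hdual (n : ℕ) : ∀ ρ τ, len r η τ = n → symF r η (Pd ρ (P τ)) = if τ = ρ then 1 else 0 := by
    induction n using Nat.strong_induction_on with
    | _ n ih =>
      rintro ρ τ rfl
      have h := congrArg (fun f => symF r η (Pd ρ f)) (hP τ)
      simp only [hPd.add, symF_add] at h
      rw [hPd.symF_sum_mul _ _ _ _ fun σ _ ρ => actF_symF ρ _,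
        Finset.sum_congr rfl fun σ hσ => by rw [ih _ (Finset.mem_filter.1 hσ).2 ρ σ rfl]] at h
      simp only [mul_ite, mul_one, mul_zero, Finset.sum_ite_eq', Finset.mem_filter,
        Finset.mem_univ, true_and] at h
      split_ifs at h with hlt
      · rw [if_neg (by rintro rfl; exact lt_irrefl _ hlt)]
        exact add_eq_right.1 h.symm
      · rw [add_zero] at h
        rw [← h]
        split_ifs with heq
        · rw [heq, hPd.symF_scaledDelta_self]
        · exact hPd.symF_scaledDelta_of_ne (Ne.symm heq) hlt
  refine ⟨P, fun f => ?_⟩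
  rw [← sub_eq_zero]
  refine hPd.eq_zero_of_symF_eq_zero fun ρ => ?_
  have h : symF r η (Pd ρ (∑ σ, symF r η (Pd σ f) * P σ)) = symF r η (Pd ρ f) := by
    rw [hPd.symF_sum_mul _ _ _ _ fun σ _ ρ => actF_symF ρ _]
    simp [hdual _ ρ _ rfl]
  have h' := congrArg (fun f => symF r η (Pd ρ f))
    (sub_add_cancel f (∑ σ, symF r η (Pd σ f) * P σ))
  simp only [hPd.add, symF_add, h] at h'
  exact add_eq_right.1 h'

section Expansion

variable {P : Sg r η → FF r η} (hP : ∀ f, f = ∑ σ, symF r η (Pd σ f) * P σ)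
include hP

theorem scaledDelta_eq (τ : Sg r η) : scaledDelta Pd τ = P τ +
    ∑ σ ∈ Finset.univ.filter (fun σ => len r η σ < len r η τ),
      symF r η (Pd σ (scaledDelta Pd τ)) * P σ :=
  (hP _).trans (hPd.sum_symF_scaledDelta_mul P τ)

theorem expansion_unique {P' : Sg r η → FF r η}
    (hP' : ∀ f, f = ∑ σ, symF r η (Pd σ f) * P' σ) : P' = P := by
  suffices H : ∀ n τ, len r η τ = n → P' τ = P τ from funext fun τ => H _ τ rfl
  intro n
  induction n using Nat.strong_induction_on with
  | _ n ih =>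
    rintro τ rfl
    have h := (hPd.scaledDelta_eq hP' τ).symm.trans (hPd.scaledDelta_eq hP τ)
    rwa [Finset.sum_congr rfl fun σ hσ => by rw [ih _ (Finset.mem_filter.1 hσ).2 σ rfl],
      add_left_inj] at h

theorem expansion_mem_diffPow (τ : Sg r η) : P τ ∈ diffPow r η (len r η τ) := by
  induction hn : len r η τ using Nat.strong_induction_on generalizing τ with
  | _ n ih =>
    subst hn
    rw [← sub_eq_of_eq_add (hPd.scaledDelta_eq hP τ)]
    refine sub_mem (hPd.scaledDelta_mem τ) (sum_mem fun σ hσ => ?_)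
    have hlt := (Finset.mem_filter.1 hσ).2
    obtain ⟨q, hq, -, h⟩ := hPd.exists_symF_scaledDelta_eq hlt
    obtain ⟨p, hp, h'⟩ := ih _ hlt σ rfl
    refine ⟨q * p, ?_, ?_⟩
    · have := Submodule.mul_mem_mul hq hp
      rwa [← pow_add, Nat.sub_add_cancel hlt.le] at this
    · rw [h, ← h']
      exact map_mul (algebraMap (Pol r η) (FF r η)) _ _

theorem exists_expansion_sub_scaledDelta_eq (τ : Sg r η) :
    ∃ q ∈ Ideal.span {q : Pol r η | q ∈ pIdeal r η ∧ ∀ ρ : Sg r η, actP r η ρ q = q},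
      P τ - scaledDelta Pd τ = algebraMap (Pol r η) (FF r η) q := by
  set I := Ideal.span {q : Pol r η | q ∈ pIdeal r η ∧ ∀ ρ : Sg r η, actP r η ρ q = q}
  suffices h : scaledDelta Pd τ - P τ ∈
      (Submodule.toAddSubgroup I).map (algebraMap (Pol r η) (FF r η)).toAddMonoidHom by
    obtain ⟨q, hq, h⟩ := neg_mem h
    exact ⟨q, hq, by rw [← neg_sub, ← h]; rfl⟩
  rw [sub_eq_of_eq_add' (hPd.scaledDelta_eq hP τ)]
  refine sum_mem fun σ hσ => ?_
  have hlt := (Finset.mem_filter.1 hσ).2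
  obtain ⟨q, hq, hinv, h⟩ := hPd.exists_symF_scaledDelta_eq hlt
  obtain ⟨p, -, h'⟩ := hPd.expansion_mem_diffPow hP σ
  refine ⟨q * p, Ideal.mul_mem_right _ _ (Ideal.subset_span
    ⟨mem_pIdeal_of_mem_diffSpan_pow (Nat.sub_ne_zero_of_lt hlt) hq, hinv⟩), ?_⟩
  rw [h, ← h']
  exact map_mul (algebraMap (Pol r η) (FF r η)) _ _

end Expansion

end IsDividedDiff

end DualBasis

/-- there is a unique family (P_σ) of elements of F with
f = Σ_σ D_σ^η(f)·P_σ for all f ∈ F; moreover each P_σ is a homogeneous polynomial of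
degree ℓ(σ) and P_σ ≡ (1/η!)·∂_{σ⁻¹w_η}(Δ_η) modulo the ideal I generated by the
S_η-invariant elements of p_η.  Here `Pd` is the family of divided difference operators
∂_σ (so D_σ^η = sym_η ∘ ∂_σ). -/
theorem statement10 (m r : ℕ) (η : Fin r → ℕ) (hpos : ∀ k, 0 < η k) (hsum : ∑ k, η k = m)
    (Pd : Sg r η → FF r η → FF r η)
    (hPd : ∀ (σ : Sg r η) (w : Word r η), IsRed r η σ w → ∀ f, Pd σ f = ddWord r η w f) :
    (∃! P : Sg r η → FF r η, ∀ f : FF r η,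
      f = ∑ σ : Sg r η, symF r η (Pd σ f) * P σ) ∧
    (∀ P : Sg r η → FF r η,
      (∀ f : FF r η, f = ∑ σ : Sg r η, symF r η (Pd σ f) * P σ) →
      ∀ σ : Sg r η, ∃ p : Pol r η,
        p.IsHomogeneous (len r η σ) ∧ algebraMap (Pol r η) (FF r η) p = P σ ∧
        ∃ q ∈ Ideal.span {q : Pol r η | q ∈ pIdeal r η ∧ ∀ ρ : Sg r η, actP r η ρ q = q},
          P σ - (etaFact r η : FF r η)⁻¹ * Pd (σ⁻¹ * wEta r η) (DeltaF r η) =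
            algebraMap (Pol r η) (FF r η) q) := by
  have hPd : IsDividedDiff Pd := hPd
  refine ⟨?_, fun P hP σ => ?_⟩
  · obtain ⟨P, hP⟩ := hPd.exists_expansion
    exact ⟨P, hP, fun P' hP' => hPd.expansion_unique hP hP'⟩
  · obtain ⟨p, hp, h⟩ := hPd.expansion_mem_diffPow hP σ
    exact ⟨p, isHomogeneous_of_mem_diffSpan_pow hp, h,
      hPd.exists_expansion_sub_scaledDelta_eq hP σ⟩

end GTpaper

end
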